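/- arXiv:math/9910087 — 3 statements merged into one kernel-verified Lean document; each statement's English description precedes it below -/
import Mathlib

section
/- Let n ≥ 2 and k ≥ 1 be integers. Let S^{(k)} denote the k-riffle shuffle measure, C the cut measure, and U the uniform distribution on the relevant symmetric group. Then the total variation distance on S_n between C∗S^{(k)} and the uniform distribution equals the total variation distance on S_{n−1} between S^{(k)} and the uniform distribution: ‖C∗S^{(k)} − U‖_{S_n} = ‖S^{(k)} − U‖_{S_{n−1}}. -/
/-- The number of descents of a permutation `w` of `Fin n`: positions `i` (0-based,
`i + 1 < n`) with `w (i+1) < w i`.  (In 1-based terms: `1 ≤ i ≤ n-1` with `w(i) > w(i+1)`.) -/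
def numDescents {n : ℕ} (w : Equiv.Perm (Fin n)) : ℕ :=
  (Finset.univ.filter (fun i : Fin n => (i : ℕ) + 1 < n ∧ w (finRotate n i) < w i)).card

/-- The `k`-riffle shuffle probability measure on `Sₙ`:
`S⁽ᵏ⁾(w) = (1/kⁿ) C(n + k - d(w⁻¹) - 1, n)`. -/
noncomputable def riffleMeasure (n k : ℕ) (w : Equiv.Perm (Fin n)) : ℝ :=
  (1 / (k : ℝ) ^ n) * (Nat.choose (n + k - numDescents w⁻¹ - 1) n : ℝ)

/-- The cut measure on `Sₙ`: probability `1/n` on each power `ζ^i`, `0 ≤ i ≤ n-1`,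
of the `n`-cycle `ζ = (1 2 ⋯ n)`, and `0` elsewhere. -/
noncomputable def cutMeasure (n : ℕ) (w : Equiv.Perm (Fin n)) : ℝ :=
  (((Finset.range n).filter (fun i => finRotate n ^ i = w)).card : ℝ) / (n : ℝ)

/-- The convolution of two measures on a finite group: `(P∗Q)(π) = Σ_τ P(π τ⁻¹) Q(τ)`. -/
noncomputable def convMeasure {G : Type*} [Group G] [Fintype G] (P Q : G → ℝ) : G → ℝ :=
  fun g => ∑ τ : G, P (g * τ⁻¹) * Q τ

/-- The total variation distance between two measures on a finite set. -/
noncomputable def tvDist {X : Type*} [Fintype X] (P₁ P₂ : X → ℝ) : ℝ :=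
  (1 / 2) * ∑ x : X, |P₁ x - P₂ x|

def cycDes {n : ℕ} (u : Equiv.Perm (Fin n)) : Finset (Fin n) :=
  Finset.univ.filter (fun i : Fin n => u (finRotate n i) < u i)

theorem finRotate_pow_eq (p : ℕ) (i : ℕ) :
    finRotate (p+2) ^ i = Equiv.addRight (Fin.ofNat (p+2) i) := by
  induction i with
  | zero => ext x; simp
  | succ i ih =>
    rw [pow_succ', ih]
    ext x
    simp [finRotate_apply, Fin.val_add, add_assoc]

theorem conv_eq (p k : ℕ) (g : Equiv.Perm (Fin (p+2))) :
    convMeasure (cutMeasure (p+2)) (riffleMeasure (p+2) k) g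
      = (1 / ((p:ℝ)+2)) * ∑ j : Fin (p+2), riffleMeasure (p+2) k ((Equiv.addRight j)⁻¹ * g) := by
  have h1 : ∀ w : Equiv.Perm (Fin (p+2)), cutMeasure (p+2) w
      = (1 / ((p:ℝ)+2)) * ∑ j : Fin (p+2), if Equiv.addRight j = w then (1:ℝ) else 0 := by
    intro w
    have : ∑ j : Fin (p+2), (if Equiv.addRight j = w then (1:ℝ) else 0)
        = ∑ j : Fin (p+2), (fun i : ℕ => if finRotate (p+2) ^ i = w then (1:ℝ) else 0) j := by
      refine Finset.sum_congr rfl fun j _ => ?_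
      simp only [finRotate_pow_eq, Fin.ofNat_val_eq_self]
    rw [this, Fin.sum_univ_eq_sum_range
      (fun i : ℕ => if finRotate (p+2) ^ i = w then (1:ℝ) else 0)]
    unfold cutMeasure
    rw [Finset.sum_boole]
    push_cast
    ring
  unfold convMeasure
  simp only [h1, mul_assoc, Finset.sum_mul]
  rw [← Finset.mul_sum, Finset.sum_comm]
  congr 1
  refine Finset.sum_congr rfl fun j _ => ?_
  rw [Finset.sum_eq_single ((Equiv.addRight j)⁻¹ * g)]
  · simp
  · intro τ _ hτ
    rw [if_neg, zero_mul]
    intro h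
    apply hτ
    rw [h]; group
  · simp

theorem numDescents_rot (p : ℕ) (u : Equiv.Perm (Fin (p+2))) (j : Fin (p+2)) :
    numDescents (u * Equiv.addRight j) = ((cycDes u).erase (Fin.last _ + j)).card := by
  unfold numDescents
  rw [← Finset.card_map (Equiv.addRight j).toEmbedding]
  congr 1
  ext x
  simp only [Finset.mem_map_equiv, cycDes, Finset.mem_erase, Finset.mem_filter, Finset.mem_univ,
    true_and, finRotate_apply, Equiv.Perm.mul_apply, Equiv.coe_addRight, Equiv.addRight_symm]
  have e1 : x + -j + 1 + j = x + 1 := by abel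
  have e2 : x + -j + j = x := by abel
  rw [e1, e2]
  refine and_congr_left fun _ => ?_
  have e3 : x = Fin.last (p+1) + j ↔ x + -j = Fin.last (p+1) := by
    rw [← sub_eq_add_neg, sub_eq_iff_eq_add]
  rw [ne_eq, e3, Fin.ext_iff, Fin.val_last]
  have := (x + -j).isLt
  omega

theorem cycDes_rot (p : ℕ) (u : Equiv.Perm (Fin (p+2))) (j : Fin (p+2)) :
    (cycDes (u * Equiv.addRight j)).card = (cycDes u).card := by
  rw [← Finset.card_map (Equiv.addRight j).toEmbedding]
  congr 1
  ext x
  simp only [Finset.mem_map_equiv, cycDes, Finset.mem_filter, Finset.mem_univ,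
    true_and, finRotate_apply, Equiv.Perm.mul_apply, Equiv.coe_addRight, Equiv.addRight_symm]
  have e1 : x + -j + 1 + j = x + 1 := by abel
  have e2 : x + -j + j = x := by abel
  rw [e1, e2]

theorem sum_rot (p : ℕ) (u : Equiv.Perm (Fin (p+2))) (f : ℕ → ℝ) :
    ∑ j : Fin (p+2), f (numDescents (u * Equiv.addRight j))
      = (cycDes u).card * f ((cycDes u).card - 1)
        + ((p:ℝ) + 2 - (cycDes u).card) * f (cycDes u).card := by
  simp only [numDescents_rot]
  have hs := Equiv.sum_comp (Equiv.addLeft (Fin.last (p+1)))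
    (fun j => f ((cycDes u).erase j).card)
  simp only [Equiv.coe_addLeft] at hs
  rw [hs]
  rw [← Finset.sum_add_sum_compl (cycDes u)]
  congr 1
  · rw [Finset.sum_congr rfl (fun j hj => by rw [Finset.card_erase_of_mem hj])]
    simp
  · rw [Finset.sum_congr rfl (fun j hj => by
      rw [Finset.erase_eq_of_notMem (Finset.mem_compl.1 hj)])]
    have h := Finset.card_le_univ (cycDes u)
    simp only [Fintype.card_fin] at h
    simp [Finset.card_compl, Nat.cast_sub h]

theorem cycDes_ext (p : ℕ) (v : Equiv.Perm (Fin (p+1))) :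
    (cycDes (Equiv.Perm.decomposeFin.symm (0, v))).card = numDescents v + 1 := by
  unfold cycDes numDescents
  rw [Fin.card_filter_univ_succ]
  have h0 : ¬ (Equiv.Perm.decomposeFin.symm (0, v) (finRotate (p+2) 0)
      < Equiv.Perm.decomposeFin.symm (0, v) 0) := by
    simp
  rw [if_neg h0]
  rw [← Finset.card_insert_of_notMem (a := Fin.last p)]
  · congr 1
    ext i
    simp only [Finset.mem_filter, Finset.mem_univ, true_and, Finset.mem_insert, Function.comp]
    rcases Fin.eq_castSucc_or_eq_last i with ⟨i, rfl⟩ | rfl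
    · have e : finRotate (p+2) (Fin.succ i.castSucc) = Fin.succ (Fin.succ i) := by
        rw [finRotate_apply]
        ext; simp [Fin.val_add_one, Fin.ext_iff]; omega
      have e' : finRotate (p+1) i.castSucc = i.succ := by
        rw [finRotate_apply]; simp
      rw [e, e']
      simp [(Fin.castSucc_lt_last i).ne]
    · have e : finRotate (p+2) (Fin.succ (Fin.last p)) = 0 := by
        rw [finRotate_apply]; simp
      rw [e, Equiv.Perm.decomposeFin_symm_apply_zero, Equiv.Perm.decomposeFin_symm_apply_succ]
      simp
  · simp

theorem choose_id (n k d : ℕ) (hk : 1 ≤ k) (hd : d ≤ n) :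
    (d + 1) * Nat.choose (n + 1 + k - d - 1) (n+1)
      + (n + 1 - (d + 1)) * Nat.choose (n + 1 + k - (d+1) - 1) (n+1)
      = k * Nat.choose (n + k - d - 1) n := by
  obtain ⟨N, hN⟩ : ∃ N, N = n + k - d - 1 := ⟨_, rfl⟩
  have e1 : n + 1 + k - d - 1 = N + 1 := by omega
  have e2 : n + 1 + k - (d+1) - 1 = N := by omega
  rw [e1, e2, ← hN, Nat.choose_succ_succ]
  have h := Nat.choose_succ_right_eq N n
  rcases lt_or_ge N n with hlt | hge
  · rw [Nat.choose_eq_zero_of_lt hlt, Nat.choose_eq_zero_of_lt (by omega : N < n+1)]; simp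
  · have e3 : n + 1 - (d+1) = n - d := by omega
    obtain ⟨a, rfl⟩ := Nat.exists_eq_add_of_le hd
    have e4 : k = (N - (d+a)) + (d + 1) := by omega
    rw [e3, Nat.add_sub_cancel_left, e4]
    linarith

theorem numDescents_le (p : ℕ) (v : Equiv.Perm (Fin (p+1))) : numDescents v ≤ p + 1 := by
  unfold numDescents
  exact (Finset.card_le_univ _).trans (by simp)

theorem conv_key (p k : ℕ) (hk : 1 ≤ k) (v : Equiv.Perm (Fin (p+1))) (j : Fin (p+2)) :
    convMeasure (cutMeasure (p+2)) (riffleMeasure (p+2) k)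
      (Equiv.Perm.decomposeFin.symm (0, v) * Equiv.addRight j)⁻¹
      = (1 / ((p:ℝ)+2)) * riffleMeasure (p+1) k v⁻¹ := by
  rw [conv_eq]
  congr 1
  unfold riffleMeasure
  simp only [mul_inv_rev, inv_inv]
  set u := Equiv.Perm.decomposeFin.symm (0, v) * Equiv.addRight j with hu
  have h := sum_rot p u
    (fun d => 1 / (k:ℝ) ^ (p+2) * (Nat.choose (p + 2 + k - d - 1) (p+2) : ℝ))
  simp only [hu, cycDes_rot, cycDes_ext] at h
  simp only [hu] at *
  rw [h]
  have hd := numDescents_le p v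
  have hc := choose_id (p+1) k (numDescents v) hk hd
  have hc' := congrArg (Nat.cast : ℕ → ℝ) hc
  rw [Nat.cast_add, Nat.cast_mul, Nat.cast_mul, Nat.cast_mul, Nat.cast_sub (by omega)] at hc'
  have hk0 : (k:ℝ) ≠ 0 := by positivity
  rw [pow_succ (k:ℝ) (p+1)]
  rw [Nat.add_sub_cancel]
  field_simp
  rw [mul_comm (k:ℝ), mul_comm _ (k:ℝ), ← hc']
  push_cast
  ring

theorem ext_bij (p : ℕ) : Function.Bijective
    (fun x : Fin (p+2) × Equiv.Perm (Fin (p+1)) =>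
      (Equiv.Perm.decomposeFin.symm (0, x.2) * Equiv.addRight x.1)⁻¹) := by
  rw [Fintype.bijective_iff_injective_and_card]
  constructor
  · rintro ⟨j, v⟩ ⟨j', v'⟩ h
    have h := inv_injective h
    simp only at h
    have h0 := congrArg (fun e : Equiv.Perm (Fin (p+2)) => e (-j)) h
    simp only [Equiv.Perm.mul_apply, Equiv.coe_addRight, neg_add_cancel,
      Equiv.Perm.decomposeFin_symm_apply_zero] at h0
    have h1 : -j + j' = 0 := by
      apply (Equiv.Perm.decomposeFin.symm (0, v')).injective
      rw [← h0, Equiv.Perm.decomposeFin_symm_apply_zero]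
    have hj : j = j' := by
      rw [neg_add_eq_zero] at h1; exact h1
    subst hj
    have h2 := Equiv.Perm.decomposeFin.symm.injective (mul_right_cancel h)
    simp only [Prod.mk.injEq, true_and] at h2
    rw [h2]
  · simp [Fintype.card_perm, Nat.factorial_succ]

/-- For `n ≥ 2`: `‖C∗S⁽ᵏ⁾ - U‖_{Sₙ} = ‖S⁽ᵏ⁾ - U‖_{S_{n-1}}`. -/
theorem tvDist_cut_shuffle_eq (n k : ℕ) (hn : 2 ≤ n) (hk : 1 ≤ k) :
    tvDist (convMeasure (cutMeasure n) (riffleMeasure n k))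
        (fun _ => 1 / (Fintype.card (Equiv.Perm (Fin n)) : ℝ))
      = tvDist (riffleMeasure (n - 1) k)
          (fun _ => 1 / (Fintype.card (Equiv.Perm (Fin (n - 1))) : ℝ)) := by
  obtain ⟨p, rfl⟩ : ∃ p, n = p + 2 := ⟨n - 2, by omega⟩
  have e : p + 2 - 1 = p + 1 := rfl
  rw [e]
  unfold tvDist
  congr 1
  rw [← (ext_bij p).sum_comp
    (fun g => |convMeasure (cutMeasure (p+2)) (riffleMeasure (p+2) k) g
      - 1 / (Fintype.card (Equiv.Perm (Fin (p+2))) : ℝ)|)]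
  rw [Fintype.sum_prod_type]
  simp only [conv_key p k hk]
  rw [Finset.sum_const, Finset.card_univ, Fintype.card_fin, nsmul_eq_mul, Finset.mul_sum]
  rw [← Equiv.sum_comp (Equiv.inv (Equiv.Perm (Fin (p+1))))]
  refine Finset.sum_congr rfl fun v _ => ?_
  have hp : (0:ℝ) < ((p+2 : ℕ) : ℝ) := by positivity
  rw [← abs_of_pos hp, ← abs_mul]
  congr 1
  simp only [Fintype.card_perm, Fintype.card_fin, Equiv.inv_apply, inv_inv]
  rw [Nat.factorial_succ (p+1)]
  have hf : ((p+1).factorial : ℝ) ≠ 0 := by positivity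
  push_cast
  have : (p:ℝ) + 2 ≠ 0 := by positivity
  have : (p:ℝ) + 1 + 1 ≠ 0 := by positivity
  field_simp
  ring
end

section
/- Let n be a prime and let q be a positive power of n. Then for every w ∈ S_n, Σ_{r | n, r | q − cd(w)} C((n + q − cd(w) − r)/r, (q − cd(w))/r) · C_r(−maj(w)) = C(n + q − cd(w) − 1, n − 1); consequently the type A affine q-shuffle measure coincides exactly with the measure of a q-riffle shuffle followed by a cut. -/
/-- The number of cyclic descents of `w`: `numDescents w + 1` if `w(n) > w(1)`
(i.e. `w (n-1) > w 0` in 0-based terms), and `numDescents w` otherwise. -/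
def numCyclicDescents {n : ℕ} (w : Equiv.Perm (Fin n)) : ℕ :=
  (Finset.univ.filter (fun i : Fin n => w (finRotate n i) < w i)).card

/-- The major index of `w`: the sum of the (1-based) positions at which `w` has a descent. -/
def majIndex {n : ℕ} (w : Equiv.Perm (Fin n)) : ℕ :=
  ∑ i ∈ Finset.univ.filter (fun i : Fin n => (i : ℕ) + 1 < n ∧ w (finRotate n i) < w i),
    ((i : ℕ) + 1)

/-- The Ramanujan sum `C_r(m) = Σ_l e^{2πi l m / r}`, the sum being over all integers
`l` with `1 ≤ l ≤ r` relatively prime to `r`. -/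
noncomputable def ramanujanSum (r : ℕ) (m : ℤ) : ℂ :=
  ∑ l ∈ (Finset.Icc 1 r).filter (fun l => Nat.Coprime l r),
    Complex.exp (2 * Real.pi * Complex.I * (l : ℂ) * (m : ℂ) / (r : ℂ))

/-- The type `A` affine `q`-shuffle measure on `Sₙ` (for `q > cd(w⁻¹)` this is the first
branch; the paper's full definition includes the degenerate cases). -/
noncomputable def affineShuffle (n q : ℕ) (w : Equiv.Perm (Fin n)) : ℂ :=
  if numCyclicDescents w⁻¹ < q then
    (1 / ((n : ℂ) * (q : ℂ) ^ (n - 1))) *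
      ∑ r ∈ (Nat.divisors n).filter (fun r => r ∣ q - numCyclicDescents w⁻¹),
        (Nat.choose ((n + q - numCyclicDescents w⁻¹ - r) / r)
            ((q - numCyclicDescents w⁻¹) / r) : ℂ)
          * ramanujanSum r (-(majIndex w⁻¹ : ℤ))
  else if q = numCyclicDescents w⁻¹ ∧ majIndex w⁻¹ % n = 0 then (1 : ℂ) / (q : ℂ) ^ (n - 1)
  else 0

theorem cd_pos_aux {n : ℕ} (hn : 2 ≤ n) (w : Equiv.Perm (Fin n)) :
    0 < numCyclicDescents w := by
  obtain ⟨m, rfl⟩ : ∃ m, n = m + 2 := ⟨n - 2, by omega⟩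
  unfold numCyclicDescents
  rw [Finset.card_pos]
  refine ⟨w.symm (Fin.last _), ?_⟩
  simp only [Finset.mem_filter, Finset.mem_univ, true_and, Equiv.apply_symm_apply]
  rw [Fin.lt_last_iff_ne_last]
  intro h
  have h2 : finRotate (m + 2) (w.symm (Fin.last _)) = w.symm (Fin.last _) := by
    rw [Equiv.eq_symm_apply]; exact h
  rw [finRotate_succ_apply] at h2
  simp at h2

theorem cd_lt_aux {n : ℕ} (hn : 2 ≤ n) (w : Equiv.Perm (Fin n)) :
    numCyclicDescents w < n := by
  obtain ⟨m, rfl⟩ : ∃ m, n = m + 2 := ⟨n - 2, by omega⟩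
  unfold numCyclicDescents
  conv_rhs => rw [← Fintype.card_fin (m + 2)]
  refine Finset.card_lt_univ_of_notMem (x := w.symm 0) ?_
  simp

theorem ram_one_aux (m : ℤ) : ramanujanSum 1 m = 1 := by
  unfold ramanujanSum
  have : (Finset.Icc 1 1).filter (fun l => Nat.Coprime l 1) = {1} := by decide
  rw [this, Finset.sum_singleton, Complex.exp_eq_one_iff]
  exact ⟨m, by push_cast; ring⟩

theorem sum_aux (n : ℕ) (hp : n.Prime) (a : ℕ) (ha : 1 ≤ a)
    (q : ℕ) (hq : q = n ^ a) (w : Equiv.Perm (Fin n)) :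
    numCyclicDescents w < q ∧
    ∑ r ∈ (Nat.divisors n).filter (fun r => r ∣ q - numCyclicDescents w),
            (Nat.choose ((n + q - numCyclicDescents w - r) / r)
                ((q - numCyclicDescents w) / r) : ℂ)
              * ramanujanSum r (-(majIndex w : ℤ))
          = (Nat.choose (n + q - numCyclicDescents w - 1) (n - 1) : ℂ) := by
  have h0 := cd_pos_aux hp.two_le w
  have h1 := cd_lt_aux hp.two_le w
  have hnq : n ∣ q := hq ▸ dvd_pow_self n (by omega)
  have hq0 : 0 < q := hq ▸ pow_pos hp.pos a
  have hle := Nat.le_of_dvd hq0 hnq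
  generalize numCyclicDescents w = c at *
  refine ⟨by omega, ?_⟩
  have hnd : ¬ n ∣ q - c := fun h => by
    have h2 : n ∣ c := (Nat.dvd_sub_iff_right (by omega) hnq).1 h
    exact absurd (Nat.le_of_dvd h0 h2) (by omega)
  have hf : (Nat.divisors n).filter (fun r => r ∣ q - c) = {1} := by
    ext r
    simp only [Finset.mem_filter, Nat.mem_divisors, Finset.mem_singleton]
    constructor
    · rintro ⟨⟨h, -⟩, h'⟩
      rcases (Nat.dvd_prime hp).1 h with h | h
      · exact h
      · exact absurd (h ▸ h') hnd
    · rintro rfl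
      exact ⟨⟨one_dvd _, hp.ne_zero⟩, one_dvd _⟩
  rw [hf, Finset.sum_singleton, ram_one_aux, mul_one, Nat.div_one, Nat.div_one]
  have := hp.two_le
  rw [Nat.choose_symm_of_eq_add (show n + q - c - 1 = (q - c) + (n - 1) by omega)]

/-- Let `n` be a prime and `q` a positive power of `n`.  Then for every `w ∈ Sₙ` the
divisor sum in the affine-shuffle formula collapses to a single binomial coefficient, and
consequently the type `A` affine `q`-shuffle measure coincides exactly with the measure
of a `q`-riffle shuffle followed by a cut. -/
theorem affine_eq_cut_shuffle_of_prime (n : ℕ) (hp : n.Prime) (a : ℕ) (ha : 1 ≤ a)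
    (q : ℕ) (hq : q = n ^ a) :
    (∀ w : Equiv.Perm (Fin n),
        ∑ r ∈ (Nat.divisors n).filter (fun r => r ∣ q - numCyclicDescents w),
            (Nat.choose ((n + q - numCyclicDescents w - r) / r)
                ((q - numCyclicDescents w) / r) : ℂ)
              * ramanujanSum r (-(majIndex w : ℤ))
          = (Nat.choose (n + q - numCyclicDescents w - 1) (n - 1) : ℂ))
      ∧ (∀ w : Equiv.Perm (Fin n),
          affineShuffle n q w
            = (1 / ((n : ℂ) * (q : ℂ) ^ (n - 1)))
                * (Nat.choose (n + q - numCyclicDescents w⁻¹ - 1) (n - 1) : ℂ)) := by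
  refine ⟨fun w => (sum_aux n hp a ha q hq w).2, fun w => ?_⟩
  obtain ⟨h1, h2⟩ := sum_aux n hp a ha q hq w⁻¹
  unfold affineShuffle
  rw [if_pos h1, h2]
end

section
/- Let n ≥ 5 be odd. Then the major indices of the transpositions in S_n with exactly 3 cyclic descents are equidistributed modulo n, each residue class being hit exactly (n−3)/2 times: for every residue c mod n, #{transpositions w ∈ S_n : cd(w) = 3 and maj(w) ≡ c mod n} = (n−3)/2. -/
open scoped Classical

theorem finRotate_val_aux {n : ℕ} (i : Fin n) :
    ((finRotate n i : Fin n) : ℕ) = if (i : ℕ) + 1 < n then (i : ℕ) + 1 else 0 := by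
  cases n with
  | zero => exact i.elim0
  | succ m =>
    rw [coe_finRotate]
    have := i.isLt
    split_ifs with h1 h2 h2
    · rw [Fin.ext_iff, Fin.val_last] at h1; omega
    · rfl
    · rfl
    · rw [Fin.ext_iff, Fin.val_last] at h1; omega

theorem swap_val_aux {n : ℕ} (a b x : Fin n) :
    ((Equiv.swap a b x : Fin n) : ℕ) =
      if (x : ℕ) = a then (b : ℕ) else if (x : ℕ) = b then (a : ℕ) else x := by
  rw [Equiv.swap_apply_def]
  simp only [Fin.ext_iff]
  split_ifs <;> rfl

theorem desc_iff_aux {n : ℕ} (hn : 5 ≤ n) (a b : Fin n) (hab : a < b) (i : Fin n) :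
    (Equiv.swap a b (finRotate n i) < Equiv.swap a b i) ↔
      ((i : ℕ) = a ∨ (i : ℕ) + 1 = b ∨
        ((i : ℕ) + 1 = n ∧ ¬ ((a : ℕ) = 0 ∧ (b : ℕ) + 1 = n))) := by
  rw [Fin.lt_def, swap_val_aux, swap_val_aux, finRotate_val_aux]
  have := i.isLt
  have := a.isLt
  have := b.isLt
  rw [Fin.lt_def] at hab
  split_ifs <;> omega

theorem cd_aux {n : ℕ} (hn : 5 ≤ n) (a b : Fin n) (hab : a < b) :
    numCyclicDescents (Equiv.swap a b) = 3 ↔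
      ((a : ℕ) + 1 < b ∧ ¬ ((a : ℕ) = 0 ∧ (b : ℕ) + 1 = n)) := by
  have ha := a.isLt
  have hb := b.isLt
  have hab' := hab
  rw [Fin.lt_def] at hab'
  unfold numCyclicDescents
  constructor
  · intro h
    by_contra hc
    have hle : (Finset.univ.filter (fun i : Fin n =>
        Equiv.swap a b (finRotate n i) < Equiv.swap a b i)).card ≤ 2 := by
      by_cases h0 : (a : ℕ) = 0 ∧ (b : ℕ) + 1 = n
      · refine le_trans (Finset.card_le_card (t := {a, ⟨b - 1, by omega⟩}) ?_)
          Finset.card_le_two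
        intro i hi
        simp only [Finset.mem_filter, Finset.mem_univ, true_and, desc_iff_aux hn a b hab] at hi
        simp only [Finset.mem_insert, Finset.mem_singleton, Fin.ext_iff]
        omega
      · refine le_trans (Finset.card_le_card (t := {a, ⟨n - 1, by omega⟩}) ?_)
          Finset.card_le_two
        intro i hi
        simp only [Finset.mem_filter, Finset.mem_univ, true_and, desc_iff_aux hn a b hab] at hi
        simp only [Finset.mem_insert, Finset.mem_singleton, Fin.ext_iff]
        omega
    have h' := h
    have : (3 : ℕ) ≤ 2 := by
      rw [← h]
      convert hle
    omega
  · rintro ⟨h1, h2⟩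
    rw [Finset.card_eq_three]
    refine ⟨a, ⟨b - 1, by omega⟩, ⟨n - 1, by omega⟩, ?_, ?_, ?_, ?_⟩
    · rw [Ne, Fin.ext_iff]; simp only; omega
    · rw [Ne, Fin.ext_iff]; simp only; omega
    · rw [Ne, Fin.ext_iff]; simp only; omega
    · ext i
      simp only [Finset.mem_filter, Finset.mem_univ, true_and, desc_iff_aux hn a b hab,
        Finset.mem_insert, Finset.mem_singleton, Fin.ext_iff]
      omega

theorem maj_aux {n : ℕ} (hn : 5 ≤ n) (a b : Fin n) (hab : (a : ℕ) + 1 < b) :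
    majIndex (Equiv.swap a b) = a + b + 1 := by
  have ha := a.isLt
  have hb := b.isLt
  have hab' : a < b := by rw [Fin.lt_def]; omega
  unfold majIndex
  have : (Finset.univ.filter (fun i : Fin n => (i : ℕ) + 1 < n ∧
      Equiv.swap a b (finRotate n i) < Equiv.swap a b i)) = {a, ⟨b - 1, by omega⟩} := by
    ext i
    simp only [Finset.mem_filter, Finset.mem_univ, true_and, desc_iff_aux hn a b hab',
        Finset.mem_insert, Finset.mem_singleton, Fin.ext_iff]
    omega
  rw [this, Finset.sum_pair]
  · simp only; omega
  · rw [Ne, Fin.ext_iff]; simp only; omega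

theorem mod_aux {n t r : ℕ} (hr : r < n) (ht : t < 2 * n) :
    t % n = r ↔ (t = r ∨ t = r + n) := by
  constructor
  · intro h
    by_cases h1 : t < n
    · rw [Nat.mod_eq_of_lt h1] at h; exact Or.inl h
    · rw [Nat.mod_eq_sub_mod (by omega), Nat.mod_eq_of_lt (by omega)] at h
      omega
  · rintro (h | h)
    · rw [h, Nat.mod_eq_of_lt hr]
    · rw [h, Nat.add_mod_right, Nat.mod_eq_of_lt hr]

theorem count_aux (n : ℕ) (hn : 5 ≤ n) (hodd : n % 2 = 1) (r : ℕ) (hr : r < n) :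
    (Finset.univ.filter (fun p : Fin n × Fin n =>
      ((p.1 : ℕ) + 1 < p.2 ∧ ¬ ((p.1 : ℕ) = 0 ∧ (p.2 : ℕ) + 1 = n)) ∧
        ((p.1 : ℕ) + p.2 + 1 = r ∨ (p.1 : ℕ) + p.2 + 1 = r + n))).card = (n - 3) / 2 := by
  have hI : (Finset.Icc 1 ((n - 3) / 2)).card = (n - 3) / 2 := by simp
  rw [← hI]
  refine Finset.card_bij (fun p _ => if ((p.2 : ℕ) - p.1) % 2 = 0 then ((p.2 : ℕ) - p.1) / 2
    else (n - ((p.2 : ℕ) - p.1)) / 2) ?_ ?_ ?_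
  · rintro ⟨a, b⟩ h
    have ha := a.isLt
    have hb := b.isLt
    simp only [Finset.mem_filter, Finset.mem_univ, true_and] at h
    simp only [Finset.mem_Icc]
    split_ifs <;> omega
  · rintro ⟨⟨a, ha⟩, ⟨b, hb⟩⟩ h ⟨⟨a', ha'⟩, ⟨b', hb'⟩⟩ h' e
    simp only [Finset.mem_filter, Finset.mem_univ, true_and] at h h'
    simp only at e
    simp only [Prod.mk.injEq, Fin.mk.injEq]
    split_ifs at e <;> omega
  · intro k hk
    rw [Finset.mem_Icc] at hk
    have key : ∃ a b : ℕ, a < n ∧ b < n ∧ ((a + 1 < b ∧ ¬ (a = 0 ∧ b + 1 = n)) ∧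
        (a + b + 1 = r ∨ a + b + 1 = r + n)) ∧
        (if (b - a) % 2 = 0 then (b - a) / 2 else (n - (b - a)) / 2) = k := by
      obtain ⟨T, hT, hT2⟩ : ∃ T : ℕ, (T + 1 = r ∨ T + 1 = r + n) ∧ T % 2 = 0 := by
        by_cases h : r % 2 = 1
        · exact ⟨r - 1, by omega, by omega⟩
        · exact ⟨r + n - 1, by omega, by omega⟩
      by_cases h1 : T < 2 * k
      · refine ⟨(T + 2 * k) / 2, (T + 2 * n - 2 * k) / 2, ?_⟩
        split_ifs <;> omega
      · by_cases h2 : 2 * n ≤ T + 2 * k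
        · refine ⟨(T + 2 * k - 2 * n) / 2, (T - 2 * k) / 2, ?_⟩
          split_ifs <;> omega
        · refine ⟨(T - 2 * k) / 2, (T + 2 * k) / 2, ?_⟩
          split_ifs <;> omega
    obtain ⟨a, b, ha, hb, h, e⟩ := key
    exact ⟨(⟨a, ha⟩, ⟨b, hb⟩), by simpa using h, e⟩

/-- For odd `n ≥ 5`, the major indices of the transpositions in `Sₙ` with exactly `3`
cyclic descents are equidistributed modulo `n`: each residue class is hit exactly
`(n-3)/2` times. -/
theorem transpositions_three_cyclic_descents (n : ℕ) (hn : 5 ≤ n) (hodd : Odd n) :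
    ∀ c : ℕ,
      (Finset.univ.filter (fun w : Equiv.Perm (Fin n) =>
          w.IsSwap ∧ numCyclicDescents w = 3 ∧ majIndex w % n = c % n)).card
        = (n - 3) / 2 := by
  intro c
  have hr : c % n < n := Nat.mod_lt _ (by omega)
  rw [← count_aux n hn (Nat.odd_iff.mp hodd) (c % n) hr]
  symm
  refine Finset.card_bij (fun p _ => Equiv.swap p.1 p.2) ?_ ?_ ?_
  · rintro ⟨a, b⟩ h
    have ha := a.isLt
    have hb := b.isLt
    simp only [Finset.mem_filter, Finset.mem_univ, true_and] at h ⊢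
    have hab : a < b := by rw [Fin.lt_def]; omega
    refine ⟨⟨a, b, hab.ne, rfl⟩, (cd_aux hn a b hab).2 h.1, ?_⟩
    rw [maj_aux hn a b h.1.1, mod_aux hr (by omega)]
    exact h.2
  · rintro ⟨a, b⟩ h ⟨a', b'⟩ h' e
    simp only [Finset.mem_filter, Finset.mem_univ, true_and] at h h'
    simp only at e
    have e1 := congrArg Fin.val (congrArg (fun w : Equiv.Perm (Fin n) => w a) e)
    have e2 := congrArg Fin.val (congrArg (fun w : Equiv.Perm (Fin n) => w b) e)
    simp only [swap_val_aux] at e1 e2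
    simp only [Prod.mk.injEq, Fin.ext_iff]
    split_ifs at e1 e2 <;> omega
  · intro w hw
    simp only [Finset.mem_filter, Finset.mem_univ, true_and] at hw
    obtain ⟨⟨x, y, hxy, rfl⟩, h3, hm⟩ := hw
    have key : ∃ a b : Fin n, a < b ∧ Equiv.swap x y = Equiv.swap a b := by
      rcases lt_or_gt_of_ne hxy with h | h
      · exact ⟨x, y, h, rfl⟩
      · exact ⟨y, x, h, Equiv.swap_comm x y⟩
    obtain ⟨a, b, hab, e⟩ := key
    rw [e] at h3 hm ⊢
    have h := (cd_aux hn a b hab).1 h3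
    rw [maj_aux hn a b h.1, mod_aux hr (by omega)] at hm
    refine ⟨(a, b), ?_, rfl⟩
    simp only [Finset.mem_filter, Finset.mem_univ, true_and]
    exact ⟨h, hm⟩
end
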